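/- arXiv:2604.08533 — 2 statements merged into one kernel-verified Lean document; each statement's English description precedes it below -/
import Mathlib

section
/- Let M be a ℤⁿ-graded F-finite F-module over R = K[X₁,…,Xₙ], where K is a field of characteristic p > 0, and let U ⊆ {1,…,n}. Then the following are equivalent: (i) M_u ≠ 0 for all u ∈ B(U); (ii) M_w ≠ 0 for some w ∈ B(U). Moreover, for any u, v ∈ B(U) the components M_u and M_v are isomorphic as K-vector spaces (via compositions of the multiplication maps by the variables Xᵢ). -/
set_option maxHeartbeats 1000000
set_option synthInstance.maxHeartbeats 1000000

open scoped TensorProduct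

noncomputable section

/-- `R = A[X₁, …, Xₙ]`, the polynomial ring in `n` variables over `A`,
`ℕⁿ`-graded with `A` in degree `0` and `deg Xⱼ = eⱼ`. -/
abbrev PolyR (n : ℕ) (A : Type) [CommRing A] : Type := MvPolynomial (Fin n) A

/-- A polynomial is (multi)homogeneous of degree `d ∈ ℤⁿ` if every monomial occurring in it
has exponent vector `d` (under the grading `deg Xⱼ = eⱼ`). -/
def IsHomog {n : ℕ} {A : Type} [CommRing A] (r : PolyR n A) (d : Fin n → ℤ) : Prop :=
  ∀ m ∈ r.support, (fun i => ((m i : ℕ) : ℤ)) = d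

/-- Type synonym: `R` viewed as an `R`-algebra via the Frobenius `r ↦ r ^ p`. -/
@[nolint unusedArguments]
def FrobTwist (_p n : ℕ) (A : Type) [CommRing A] : Type := PolyR n A

instance (p n : ℕ) (A : Type) [CommRing A] : CommRing (FrobTwist p n A) :=
  inferInstanceAs (CommRing (PolyR n A))

/-- The Frobenius `r ↦ r ^ p`, as a ring homomorphism `R →+* FrobTwist p n A`. -/
def frobToTwist (p n : ℕ) (A : Type) [CommRing A] [Fact p.Prime] [CharP A p] :
    PolyR n A →+* FrobTwist p n A := frobenius (PolyR n A) p

/-- The `R`-algebra structure on `FrobTwist p n A` given by the Frobenius. -/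
instance (p n : ℕ) (A : Type) [CommRing A] [Fact p.Prime] [CharP A p] :
    Algebra (PolyR n A) (FrobTwist p n A) := (frobToTwist p n A).toAlgebra

/-- `F(M) = R ⊗_R M`, the base change of `M` along the Frobenius endomorphism of `R`,
an `R`-module via the left factor. -/
def FF (p n : ℕ) (A : Type) [CommRing A] [Fact p.Prime] [CharP A p]
    (M : Type) [AddCommGroup M] [Module (PolyR n A) M] : Type :=
  FrobTwist p n A ⊗[PolyR n A] M

section FFInst

variable (p n : ℕ) (A : Type) [CommRing A] [Fact p.Prime] [CharP A p]
variable (M N : Type) [AddCommGroup M] [Module (PolyR n A) M]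
  [AddCommGroup N] [Module (PolyR n A) N]

instance : AddCommGroup (FF p n A M) :=
  inferInstanceAs (AddCommGroup (FrobTwist p n A ⊗[PolyR n A] M))

instance : Module (PolyR n A) (FF p n A M) :=
  inferInstanceAs (Module (FrobTwist p n A) (FrobTwist p n A ⊗[PolyR n A] M))

instance : Module A (FF p n A M) :=
  Module.compHom (FF p n A M) (algebraMap A (PolyR n A))

instance : IsScalarTower A (PolyR n A) (FF p n A M) where
  smul_assoc a r x := by
    show ((a • r) • x : FF p n A M) = (algebraMap A (PolyR n A) a) • (r • x)
    rw [Algebra.smul_def, mul_smul]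

/-- Inclusion of elements of the tensor product into `F(M)`. -/
def FF.of (x : FrobTwist p n A ⊗[PolyR n A] M) : FF p n A M := x

/-- An element of `R`, viewed in `FrobTwist p n A`. -/
def twist (r : PolyR n A) : FrobTwist p n A := r

/-- The degree-`u` component of `F(M)` induced by a grading `gr` on `M`:
the `A`-span of the homogeneous tensors `r ⊗ m` with `deg(r ⊗ m) = deg r + p • deg m = u`. -/
def FF.comp [Module A M] (gr : (Fin n → ℤ) → Submodule A M) (u : Fin n → ℤ) :
    Submodule A (FF p n A M) :=
  Submodule.span A { x : FF p n A M |
    ∃ (r : PolyR n A) (d v : Fin n → ℤ) (m : M),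
      IsHomog r d ∧ m ∈ gr v ∧ d + p • v = u ∧
      x = FF.of p n A M (twist p n A r ⊗ₜ[PolyR n A] m) }

/-- Functoriality of `F`. -/
def FF.map {M N} [AddCommGroup M] [Module (PolyR n A) M]
    [AddCommGroup N] [Module (PolyR n A) N] (f : M →ₗ[PolyR n A] N) :
    FF p n A M →ₗ[PolyR n A] FF p n A N :=
  LinearMap.baseChange (FrobTwist p n A) f

end FFInst

/-- A bundled `ℤⁿ`-graded module over `R = A[X₁,…,Xₙ]`: a module together with a family of
`A`-submodules indexed by `ℤⁿ` (the candidate graded components). -/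
structure GrMod (p n : ℕ) (A : Type) [CommRing A] [Fact p.Prime] [CharP A p] : Type 1 where
  carrier : Type
  [acg : AddCommGroup carrier]
  [modA : Module A carrier]
  [modR : Module (PolyR n A) carrier]
  [tower : IsScalarTower A (PolyR n A) carrier]
  gr : (Fin n → ℤ) → Submodule A carrier

attribute [instance] GrMod.acg GrMod.modA GrMod.modR GrMod.tower

variable {p n : ℕ} {A : Type} [CommRing A] [Fact p.Prime] [CharP A p]

/-- The Frobenius functor applied to a bundled graded module, with the induced grading
`deg(r ⊗ m) = deg r + p • deg m`. -/
def GrMod.F (X : GrMod p n A) : GrMod p n A where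
  carrier := FF p n A X.carrier
  gr := FF.comp p n A X.carrier X.gr

/-- Iterates `F^k(X)` of the Frobenius functor on a bundled graded module. -/
def GrMod.FPow (X : GrMod p n A) : ℕ → GrMod p n A
  | 0 => X
  | (k + 1) => (X.FPow k).F

/-- The maps `F^k(β) : F^k(U) → F^(k+1)(U)` of the direct system induced by a generating
morphism `β : U → F(U)`. -/
def GrMod.seqMap (X : GrMod p n A) (β : X.carrier →ₗ[PolyR n A] X.F.carrier) :
    ∀ k : ℕ, (X.FPow k).carrier →ₗ[PolyR n A] (X.FPow (k + 1)).carrier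
  | 0 => β
  | (k + 1) => FF.map p n A (X.seqMap β k)

/-- The composite transition maps `F^k(U) → F^(k+l)(U)` of the direct system. -/
def GrMod.trans (X : GrMod p n A) (β : X.carrier →ₗ[PolyR n A] X.F.carrier) :
    ∀ (k l : ℕ), (X.FPow k).carrier →ₗ[PolyR n A] (X.FPow (k + l)).carrier
  | _, 0 => LinearMap.id
  | k, (l + 1) => (X.seqMap β (k + l)).comp (X.trans β k l)

/-- `M`, together with the family `gr` of its `A`-submodule components, is a `ℤⁿ`-graded
`F`-finite `F`-module over `R = A[X₁,…,Xₙ]`.  The fields say: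
* `gr` is a `ℤⁿ`-grading of `M` by `A`-submodules making `M` a graded `R`-module
  (`isInternal`, `smul_X_mem`);
* `theta : M ≅ F(M)` is a degree-preserving `R`-linear isomorphism (`theta`, `theta_grade`),
  where the grading on `F(M)` is given by `deg (r ⊗ m) = deg r + p • deg m`;
* `M` is the direct limit of `U →β F(U) →F(β) F²(U) → ⋯` for a degree-preserving generating
  morphism `β : U → F(U)` from a finitely generated `ℤⁿ`-graded module `U` (= `gen.carrier`),
  via degree-preserving structure maps `toLim k : F^k(U) → M` (`toLim_compat`, `toLim_grade`,
  `toLim_surj`, `toLim_ker` say precisely that `M` is the colimit of the system), compatibly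
  with `theta` (`theta_compat`). -/
structure ZGradedFFiniteFModule (p n : ℕ) (A : Type) [CommRing A] [Fact p.Prime] [CharP A p]
    (M : Type) [AddCommGroup M] [Module A M] [Module (PolyR n A) M]
    [IsScalarTower A (PolyR n A) M]
    (gr : (Fin n → ℤ) → Submodule A M) : Type 1 where
  isInternal : DirectSum.IsInternal gr
  smul_X_mem : ∀ (i : Fin n) (u : Fin n → ℤ), ∀ m ∈ gr u,
    (MvPolynomial.X i : PolyR n A) • m ∈ gr (u + Pi.single i 1)
  theta : M ≃ₗ[PolyR n A] FF p n A M
  theta_grade : ∀ (u : Fin n → ℤ), ∀ m ∈ gr u, theta m ∈ FF.comp p n A M gr u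
  gen : GrMod p n A
  gen_fg : Module.Finite (PolyR n A) gen.carrier
  gen_internal : DirectSum.IsInternal gen.gr
  gen_smul_X_mem : ∀ (i : Fin n) (u : Fin n → ℤ), ∀ x ∈ gen.gr u,
    (MvPolynomial.X i : PolyR n A) • x ∈ gen.gr (u + Pi.single i 1)
  beta : gen.carrier →ₗ[PolyR n A] gen.F.carrier
  beta_grade : ∀ (u : Fin n → ℤ), ∀ x ∈ gen.gr u, beta x ∈ gen.F.gr u
  toLim : ∀ k : ℕ, (gen.FPow k).carrier →ₗ[PolyR n A] M
  toLim_compat : ∀ (k : ℕ) (x : (gen.FPow k).carrier),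
    toLim (k + 1) (gen.seqMap beta k x) = toLim k x
  toLim_grade : ∀ (k : ℕ) (u : Fin n → ℤ), ∀ x ∈ (gen.FPow k).gr u, toLim k x ∈ gr u
  toLim_surj : ∀ m : M, ∃ (k : ℕ) (x : (gen.FPow k).carrier), toLim k x = m
  toLim_ker : ∀ (k : ℕ) (x : (gen.FPow k).carrier), toLim k x = 0 →
    ∃ l : ℕ, gen.trans beta k l x = 0
  theta_compat : ∀ (k : ℕ) (x : (gen.FPow k).carrier),
    theta (toLim k x) = FF.map p n A (toLim k) (gen.seqMap beta k x)

/-- The block `B(U) ⊆ ℤⁿ` associated to a subset `U ⊆ {1,…,n}`: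
`uᵢ ≥ 0` for `i ∈ U` and `uᵢ ≤ -1` for `i ∉ U`. -/
def Block (n : ℕ) (U : Set (Fin n)) : Set (Fin n → ℤ) :=
  { u | ∀ i : Fin n, (i ∈ U → 0 ≤ u i) ∧ (i ∉ U → u i ≤ -1) }

/-- The field `K` as a vector space over itself via the Frobenius. -/
def FrobField (_p : ℕ) (K : Type) : Type := K

instance (p : ℕ) (K : Type) [Field K] : AddCommGroup (FrobField p K) :=
  inferInstanceAs (AddCommGroup K)

instance (p : ℕ) (K : Type) [Field K] [Fact p.Prime] [CharP K p] : Module K (FrobField p K) :=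
  Module.compHom K (frobenius K p)

theorem exists_frobenius_coords (p : ℕ) [Fact p.Prime] (K : Type) [Field K] [CharP K p] :
    ∃ (ι : Type) (c : ι → K) (co : K → ι →₀ K),
      (∀ x, (co x).sum (fun j a => a ^ p * c j) = x) ∧
      ∀ l : ι →₀ K, l.sum (fun j a => a ^ p * c j) = 0 → l = 0 := by
  let B := Module.Basis.ofVectorSpace K (FrobField p K)
  refine ⟨_, fun j => B j, fun x => B.repr x, fun x => B.linearCombination_repr x, fun l hl => ?_⟩
  exact linearIndependent_iff.mp B.linearIndependent l hl

/-- Coordinatewise remainder of an exponent vector modulo `p`. -/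
def expMod {n : ℕ} (p : ℕ) (d : Fin n →₀ ℕ) : Fin n →₀ ℕ := d.mapRange (· % p) (Nat.zero_mod p)

/-- Coordinatewise quotient of an exponent vector by `p`. -/
def expDiv {n : ℕ} (p : ℕ) (d : Fin n →₀ ℕ) : Fin n →₀ ℕ := d.mapRange (· / p) (Nat.zero_div p)

theorem smul_expDiv_add_expMod {n : ℕ} (p : ℕ) (d : Fin n →₀ ℕ) :
    p • expDiv p d + expMod p d = d := by
  ext i
  simp [expDiv, expMod, Nat.div_add_mod]

theorem smul_add_eq_smul_add_iff {n p : ℕ} {d e r s : Fin n →₀ ℕ} (hr : ∀ i, r i < p)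
    (hs : ∀ i, s i < p) : p • d + r = p • e + s ↔ d = e ∧ r = s := by
  refine ⟨fun h => ?_, fun ⟨h, h'⟩ => by rw [h, h']⟩
  have key : ∀ i, d i = e i ∧ r i = s i := fun i => by
    have hi : p * d i + r i = p * e i + s i := by simpa using DFunLike.congr_fun h i
    have hp : 0 < p := (Nat.zero_le _).trans_lt (hr i)
    have h1 := congrArg (· / p) hi
    simp only [Nat.mul_add_div hp, Nat.div_eq_of_lt (hr i), Nat.div_eq_of_lt (hs i)] at h1
    have h2 : d i = e i := h1
    rw [h2] at hi
    exact ⟨h2, by omega⟩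
  exact ⟨Finsupp.ext fun i => (key i).1, Finsupp.ext fun i => (key i).2⟩

theorem coeff_pow_char_mul_monomial {p n : ℕ} [Fact p.Prime] {K : Type} [Field K] [CharP K p]
    (f : PolyR n K) (e : Fin n →₀ ℕ) {r s : Fin n →₀ ℕ} (hr : ∀ i, r i < p) (hs : ∀ i, s i < p)
    (c : K) :
    MvPolynomial.coeff (p • e + r) (f ^ p * MvPolynomial.monomial s c) =
      if s = r then MvPolynomial.coeff e f ^ p * c else 0 := by
  induction f using MvPolynomial.induction_on' with
  | monomial d a =>
    rw [MvPolynomial.monomial_pow, MvPolynomial.monomial_mul, MvPolynomial.coeff_monomial,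
      MvPolynomial.coeff_monomial]
    simp only [smul_add_eq_smul_add_iff hs hr]
    by_cases h1 : d = e <;> by_cases h2 : s = r <;>
      simp [h1, h2, (Fact.out : p.Prime).ne_zero]
  | add f g hf hg =>
    rw [add_pow_char, add_mul, MvPolynomial.coeff_add, hf, hg, MvPolynomial.coeff_add,
      add_pow_char]
    split_ifs <;> ring

theorem frobTwist_smul_def {p n : ℕ} [Fact p.Prime] {K : Type} [Field K] [CharP K p]
    (f g : PolyR n K) : f • twist p n K g = twist p n K (f ^ p * g) := rfl

theorem exists_frobTwist_basis (p n : ℕ) [Fact p.Prime] (K : Type) [Field K] [CharP K p] :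
    ∃ (ι : Type) (b : Module.Basis (ι × {r : Fin n →₀ ℕ // ∀ i, r i < p}) (PolyR n K)
        (FrobTwist p n K)) (co : K → ι →₀ K),
      ∀ d c j r, b.repr (twist p n K (MvPolynomial.monomial d c)) (j, r) =
        if expMod p d = r then MvPolynomial.monomial (expDiv p d) (co c j) else 0 := by
  classical
  obtain ⟨ι, c, co, hco, hli⟩ := exists_frobenius_coords p K
  have hp : p ≠ 0 := (Fact.out : p.Prime).ne_zero
  let v : ι × {r : Fin n →₀ ℕ // ∀ i, r i < p} → FrobTwist p n K :=
    fun x => twist p n K (MvPolynomial.monomial x.2.1 (c x.1))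
  let md : (Fin n →₀ ℕ) → {r : Fin n →₀ ℕ // ∀ i, r i < p} :=
    fun d => ⟨expMod p d, fun i => by simpa [expMod] using Nat.mod_lt _ (Nat.pos_of_ne_zero hp)⟩
  have expand : ∀ d a, twist p n K (MvPolynomial.monomial d a) =
      ∑ j ∈ (co a).support, MvPolynomial.monomial (expDiv p d) (co a j) • v (j, md d) := by
    intro d a
    have : ∀ j, MvPolynomial.monomial (expDiv p d) (co a j) • v (j, md d) =
        (MvPolynomial.monomial d (co a j ^ p * c j) : PolyR n K) := fun j => by
      simp only [v, md, frobTwist_smul_def, MvPolynomial.monomial_pow,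
        MvPolynomial.monomial_mul, smul_expDiv_add_expMod]
      rfl
    simp only [this]
    conv_lhs => rw [← hco a]
    exact map_sum (MvPolynomial.monomial d) _ _
  have li : LinearIndependent (PolyR n K) v := by
    rw [linearIndependent_iff]
    intro l hl
    ext ⟨j, r⟩ e
    have h1 : l.sum (fun x f => (f ^ p * MvPolynomial.monomial x.2.1 (c x.1) : PolyR n K)) = 0 :=
      hl
    have h2 := congrArg (MvPolynomial.coeff (p • e + r.1)) h1
    rw [Finsupp.sum, MvPolynomial.coeff_sum] at h2
    simp only [fun x : ι × {r : Fin n →₀ ℕ // ∀ i, r i < p} =>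
      coeff_pow_char_mul_monomial (l x) e r.2 x.2.2 (c x.1), MvPolynomial.coeff_zero] at h2
    let l' : ι →₀ K := (l.comapDomain (fun j => (j, r)) (by
      intro a _ b _ h; exact (Prod.ext_iff.mp h).1)).mapRange (MvPolynomial.coeff e) (by simp)
    have hl' : ∀ a, l' a = MvPolynomial.coeff e (l (a, r)) := fun _ => rfl
    have h3 : l' = 0 := by
      apply hli
      rw [← h2, Finsupp.sum_of_support_subset l' (s := l.support.image Prod.fst)]
      · rw [← Finset.sum_filter]
        symm
        refine Finset.sum_bij_ne_zero (fun x _ _ => x.1) ?_ ?_ ?_ ?_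
        · intro x hx _
          exact Finset.mem_image_of_mem _ (Finset.mem_filter.mp hx).1
        · intro x hx _ y hy _ hxy
          refine Prod.ext hxy (Subtype.ext ?_)
          rw [(Finset.mem_filter.mp hx).2, (Finset.mem_filter.mp hy).2]
        · intro a _ ha
          have : (a, r) ∈ l.support := by
            rw [Finsupp.mem_support_iff]
            intro h
            apply ha
            simp [hl', h, hp]
          exact ⟨(a, r), Finset.mem_filter.mpr ⟨this, rfl⟩, ha, rfl⟩
        · rintro ⟨a, s⟩ hx _
          have : s = r := Subtype.ext (Finset.mem_filter.mp hx).2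
          subst this
          rfl
      · intro a ha
        refine Finset.mem_image.mpr ⟨(a, r), ?_, rfl⟩
        rw [Finsupp.mem_support_iff] at ha ⊢
        intro h
        apply ha
        simp [hl', h]
      · intro a _
        simp [hp]
    exact DFunLike.congr_fun h3 j
  have sp : ⊤ ≤ Submodule.span (PolyR n K) (Set.range v) := by
    rintro f -
    change PolyR n K at f
    induction f using MvPolynomial.induction_on' with
    | monomial d a =>
      change twist p n K (MvPolynomial.monomial d a) ∈ _
      rw [expand]
      exact Submodule.sum_mem _ fun j _ =>
        Submodule.smul_mem _ _ (Submodule.subset_span ⟨_, rfl⟩)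
    | add f g hf hg => exact Submodule.add_mem _ hf hg
  refine ⟨ι, Module.Basis.mk li sp, co, fun d a j r => ?_⟩
  have hv : ∀ x, v x = Module.Basis.mk li sp x := fun x => by simp
  rw [expand]
  simp only [hv, map_sum, map_smul, Module.Basis.repr_self, Finsupp.smul_single, smul_eq_mul,
    mul_one, Finsupp.finsetSum_apply, Finsupp.single_apply, Prod.mk.injEq]
  have hr : md d = r ↔ expMod p d = r := by rw [Subtype.ext_iff]
  by_cases h : expMod p d = r
  · simp +contextual [hr, h]
  · simp [hr, h]

theorem expMod_lt {p n : ℕ} [Fact p.Prime] (d : Fin n →₀ ℕ) (i : Fin n) : expMod p d i < p := by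
  simpa [expMod] using Nat.mod_lt _ (Fact.out : p.Prime).pos

theorem expMod_add_eq_iff {p n : ℕ} {d e r : Fin n →₀ ℕ} (hr : ∀ i, r i < p) :
    expMod p (e + d) = expMod p (e + r) ↔ expMod p d = r := by
  simp only [DFunLike.ext_iff]
  refine forall_congr' fun i => ?_
  simp only [expMod, Finsupp.mapRange_apply, Finsupp.add_apply]
  conv_rhs => rw [← Nat.mod_eq_of_lt (hr i)]
  exact ⟨fun h => Nat.ModEq.add_left_cancel' _ h, fun h => Nat.ModEq.add_left _ h⟩

theorem expDiv_add {p n : ℕ} [Fact p.Prime] (d e : Fin n →₀ ℕ) :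
    expDiv p (e + d) = expDiv p (e + expMod p d) + expDiv p d := by
  ext i
  simp only [expDiv, expMod, Finsupp.mapRange_apply, Finsupp.add_apply]
  conv_lhs => rw [← Nat.mod_add_div (d i) p, ← add_assoc,
    Nat.add_mul_div_left _ _ (Fact.out : p.Prime).pos]

section FrobeniusTensor

variable {p n : ℕ} [Fact p.Prime] {K : Type} [Field K] [CharP K p]
  {M : Type} [AddCommGroup M] [Module (PolyR n K) M]

/-- The tensor `X ^ d · a ⊗ m` in `F(M)`. -/
def FF.mono (p : ℕ) [Fact p.Prime] [CharP K p] (d : Fin n →₀ ℕ) (a : K) (m : M) : FF p n K M :=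
  FF.of p n K M (twist p n K (MvPolynomial.monomial d a) ⊗ₜ[PolyR n K] m)

theorem FF.monomial_smul_mono (d e : Fin n →₀ ℕ) (a b : K) (m : M) :
    (MvPolynomial.monomial e b : PolyR n K) • FF.mono p d a m = FF.mono p (e + d) (b * a) m := by
  have : (MvPolynomial.monomial e b : PolyR n K) • FF.mono p d a m = FF.of p n K M
    (twist p n K (MvPolynomial.monomial e b * MvPolynomial.monomial d a) ⊗ₜ[PolyR n K] m) := rfl
  rw [this, MvPolynomial.monomial_mul]
  rfl

theorem FF.mono_smul (d : Fin n →₀ ℕ) (a : K) (f : PolyR n K) (m : M) :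
    FF.mono p d a (f • m) = f ^ p • FF.mono p d a m :=
  (TensorProduct.smul_tmul f (twist p n K (MvPolynomial.monomial d a)) m).symm

theorem FF.mono_induction {P : FF p n K M → Prop} (zero : P 0)
    (add : ∀ x y, P x → P y → P (x + y)) (mono : ∀ d a m, P (FF.mono p d a m)) (x : FF p n K M) :
    P x := by
  refine TensorProduct.induction_on x zero (fun f m => ?_) add
  change PolyR n K at f
  induction f using MvPolynomial.induction_on' with
  | monomial d a => exact mono d a m
  | add f g hf hg =>
    have : P (FF.of p n K M (twist p n K (f + g) ⊗ₜ[PolyR n K] m)) :=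
      (TensorProduct.add_tmul (R := PolyR n K) (twist p n K f) (twist p n K g) m) ▸ add _ _ hf hg
    exact this

theorem FF.comp_induction [Module K M] {gr : (Fin n → ℤ) → Submodule K M} {u : Fin n → ℤ}
    {P : FF p n K M → Prop} (zero : P 0) (add : ∀ x y, P x → P y → P (x + y))
    (mono : ∀ d a v m, m ∈ gr v → (fun i => (d i : ℤ)) + p • v = u → P (FF.mono p d a m))
    {x : FF p n K M} (hx : x ∈ FF.comp p n K M gr u) : P x := by
  refine Submodule.closure_induction (p := fun x _ => P x) zero
    (fun x y _ _ => add x y) (fun a x hx => ?_) hx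
  obtain ⟨f, d, v, m, hf, hm, hd, rfl⟩ := hx
  by_cases h0 : f = 0
  · subst h0
    have : FF.of p n K M (twist p n K 0 ⊗ₜ[PolyR n K] m) = 0 := TensorProduct.zero_tmul _ _
    rw [this, smul_zero]
    exact zero
  · obtain ⟨e, he⟩ := Finset.nonempty_of_ne_empty (mt MvPolynomial.support_eq_empty.mp h0)
    have hfe : f = MvPolynomial.monomial e (MvPolynomial.coeff e f) := by
      ext e'
      rw [MvPolynomial.coeff_monomial]
      split_ifs with h
      · rw [h]
      · by_contra hne
        apply h
        have h1 := hf e he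
        rw [← hf e' (MvPolynomial.mem_support_iff.mpr hne)] at h1
        ext i
        exact_mod_cast congrFun h1 i
    have : a • FF.of p n K M (twist p n K f ⊗ₜ[PolyR n K] m) =
        FF.mono p e (a * MvPolynomial.coeff e f) m := by
      rw [hfe, MvPolynomial.coeff_monomial, if_pos rfl]
      exact (FF.monomial_smul_mono e 0 _ a m).trans (by rw [zero_add])
    rw [this]
    exact mono _ _ v _ hm (by rw [← hd, hf e he])

theorem FF.mono_mem_comp [Module K M] {gr : (Fin n → ℤ) → Submodule K M} {u v : Fin n → ℤ}
    {d : Fin n →₀ ℕ} (a : K) {m : M} (hm : m ∈ gr v) (h : (fun i => (d i : ℤ)) + p • v = u) :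
    FF.mono p d a m ∈ FF.comp p n K M gr u := by
  classical
  refine Submodule.subset_span ⟨_, _, v, m, fun e he => ?_, hm, h, rfl⟩
  rw [Finset.mem_singleton.mp (MvPolynomial.support_monomial_subset he)]

variable (p n K M) in
theorem FF.exists_coords : ∃ (ι : Type) (co : K → ι →₀ K)
    (φ : ι → {r : Fin n →₀ ℕ // ∀ i, r i < p} → FF p n K M →+ M),
    (∀ x, (∀ j r, φ j r x = 0) → x = 0) ∧
    ∀ d a m j r, φ j r (FF.mono p d a m) =
      if expMod p d = r then
        (MvPolynomial.monomial (expDiv p d) (co a j) : PolyR n K) • m else 0 := by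
  classical
  obtain ⟨ι, b, co, hb⟩ := exists_frobTwist_basis p n K
  let Φ : FrobTwist p n K ⊗[PolyR n K] M ≃ₗ[PolyR n K] _ :=
    TensorProduct.equivFinsuppOfBasisLeft b
  refine ⟨ι, co, fun j r =>
    (Finsupp.applyAddHom (j, r)).comp Φ.toLinearMap.toAddMonoidHom, fun x hx => ?_, ?_⟩
  · exact Φ.injective ((Finsupp.ext fun ⟨j, r⟩ => hx j r).trans (map_zero Φ).symm)
  · intro d a m j r
    have := TensorProduct.equivFinsuppOfBasisLeft_apply_tmul_apply b
      (twist p n K (MvPolynomial.monomial d a)) m (j, r)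
    refine this.trans ?_
    rw [hb]
    split_ifs with h
    · rfl
    · exact zero_smul _ m

/-- Multiplication by a monomial shifts the coordinates of an element of `F(M)`. -/
theorem FF.coords_monomial_smul {ι : Type} {co : K → ι →₀ K}
    {φ : ι → {r : Fin n →₀ ℕ // ∀ i, r i < p} → FF p n K M →+ M}
    (hφ : ∀ d a m j r, φ j r (FF.mono p d a m) =
      if expMod p d = r then
        (MvPolynomial.monomial (expDiv p d) (co a j) : PolyR n K) • m else 0)
    (e : Fin n →₀ ℕ) (x : FF p n K M) (j : ι) (r : {r : Fin n →₀ ℕ // ∀ i, r i < p}) :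
    φ j ⟨expMod p (e + r.1), expMod_lt _⟩ ((MvPolynomial.monomial e 1 : PolyR n K) • x) =
      (MvPolynomial.monomial (expDiv p (e + r.1)) 1 : PolyR n K) • φ j r x := by
  induction x using FF.mono_induction with
  | zero => simp
  | add x y hx hy => rw [smul_add, map_add, hx, hy, map_add, smul_add]
  | mono d a m =>
    rw [FF.monomial_smul_mono, hφ, hφ, one_mul]
    simp only [expMod_add_eq_iff r.2]
    split_ifs with h
    · rw [smul_smul, MvPolynomial.monomial_mul, one_mul, expDiv_add, h]
    · rw [smul_zero]

theorem X_eq_monomial (i : Fin n) :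
    (MvPolynomial.X i : PolyR n K) = MvPolynomial.monomial (Finsupp.single i 1) 1 := rfl

section Graded

variable [Module K M] {gr : (Fin n → ℤ) → Submodule K M}

theorem FF.exists_X_smul_eq {i : Fin n} {u : Fin n → ℤ}
    (hsurj : u i % p = p - 1 → ∀ v : Fin n → ℤ, v i = u i / p →
      ∀ m ∈ gr (v + Pi.single i 1), ∃ m' ∈ gr v, (MvPolynomial.X i : PolyR n K) • m' = m)
    {y : FF p n K M} (hy : y ∈ FF.comp p n K M gr (u + Pi.single i 1)) :
    ∃ x ∈ FF.comp p n K M gr u, (MvPolynomial.X i : PolyR n K) • x = y := by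
  have hp := (Fact.out : p.Prime).two_le
  refine FF.comp_induction (P := fun y => ∃ x ∈ FF.comp p n K M gr u,
    (MvPolynomial.X i : PolyR n K) • x = y) ?_ (fun y z hy hz => ?_)
    (fun d a v m hm hd => ?_) hy
  · exact ⟨0, Submodule.zero_mem _, smul_zero _⟩
  · obtain ⟨y', hy', rfl⟩ := hy
    obtain ⟨z', hz', rfl⟩ := hz
    exact ⟨y' + z', Submodule.add_mem _ hy' hz', smul_add _ _ _⟩
  · have hdk : ∀ k, (d k : ℤ) + p * v k = u k + (Pi.single i 1 : Fin n → ℤ) k := fun k => by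
      simpa using congrFun hd k
    by_cases hdi : d i = 0
    · have h1 : p * v i = u i + 1 := by simpa [hdi] using hdk i
      have h2 : u i = (p - 1) + p * (v i - 1) := by linarith
      have hlt : (p : ℤ) - 1 < p := by omega
      have hmod : u i % p = p - 1 := by
        rw [h2, Int.add_mul_emod_self_left, Int.emod_eq_of_lt (by omega) hlt]
      have hdiv : u i / p = v i - 1 := by
        rw [h2, Int.add_mul_ediv_left _ _ (by omega), Int.ediv_eq_zero_of_lt (by omega) hlt,
          zero_add]
      obtain ⟨m', hm', rfl⟩ := hsurj hmod (v - Pi.single i 1) (by simp [hdiv]) m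
        (by simpa using hm)
      refine ⟨FF.mono p (Finsupp.single i (p - 1) + d) a m', FF.mono_mem_comp a hm' ?_, ?_⟩
      · ext k
        have := hdk k
        by_cases hk : i = k
        · subst hk
          simp [hdi, Nat.cast_sub (by omega : 1 ≤ p)] at this ⊢
          linarith
        · simp [Ne.symm hk] at this ⊢
          linarith
      · rw [FF.mono_smul, X_eq_monomial, FF.monomial_smul_mono, MvPolynomial.monomial_pow,
          FF.monomial_smul_mono, ← add_assoc, ← Finsupp.single_add, Finsupp.smul_single,
          one_pow, smul_eq_mul, mul_one, Nat.add_sub_cancel' (by omega : 1 ≤ p)]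
    · have hle : Finsupp.single i 1 ≤ d := by
        rw [Finsupp.single_le_iff]
        omega
      refine ⟨FF.mono p (d - Finsupp.single i 1) a m, FF.mono_mem_comp a hm ?_, ?_⟩
      · ext k
        have := hdk k
        by_cases hk : i = k
        · subst hk
          simp [Nat.cast_sub (by omega : 1 ≤ d i)] at this ⊢
          linarith
        · simp [Ne.symm hk] at this ⊢
          linarith
      · rw [X_eq_monomial, FF.monomial_smul_mono, one_mul, add_tsub_cancel_of_le hle]

theorem exists_X_smul_eq_of_isInternal (hint : DirectSum.IsInternal gr)
    (hX : ∀ (i : Fin n) (u : Fin n → ℤ), ∀ m ∈ gr u,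
      (MvPolynomial.X i : PolyR n K) • m ∈ gr (u + Pi.single i 1))
    {i : Fin n} {u : Fin n → ℤ} {m : M}
    (hm : (MvPolynomial.X i : PolyR n K) • m ∈ gr (u + Pi.single i 1)) :
    ∃ m' ∈ gr u, (MvPolynomial.X i : PolyR n K) • m' = (MvPolynomial.X i : PolyR n K) • m := by
  classical
  let := hint.chooseDecomposition
  have key : ∀ m, (DirectSum.decompose gr ((MvPolynomial.X i : PolyR n K) • m)
      (u + Pi.single i 1) : M) =
        (MvPolynomial.X i : PolyR n K) • (DirectSum.decompose gr m u : M) := by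
    intro m
    induction m using DirectSum.Decomposition.inductionOn gr with
    | zero => simp
    | @homogeneous w m =>
      by_cases h : w = u
      · subst h
        rw [DirectSum.decompose_of_mem_same gr (hX i _ _ m.2),
          DirectSum.decompose_of_mem_same gr m.2]
      · rw [DirectSum.decompose_of_mem_ne gr (hX i _ _ m.2) (fun h' => h (add_right_cancel h')),
          DirectSum.decompose_of_mem_ne gr m.2 h, smul_zero]
    | add m m' h h' =>
      simp only [smul_add, DirectSum.decompose_add, DirectSum.add_apply, Submodule.coe_add, h, h']
  exact ⟨_, (DirectSum.decompose gr m u).2, by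
    rw [← key m, DirectSum.decompose_of_mem_same gr hm]⟩

variable [IsScalarTower K (PolyR n K) M]

theorem monomial_smul_mem
    (hX : ∀ (i : Fin n) (u : Fin n → ℤ), ∀ m ∈ gr u,
      (MvPolynomial.X i : PolyR n K) • m ∈ gr (u + Pi.single i 1))
    (d : Fin n →₀ ℕ) (a : K) {u : Fin n → ℤ} {m : M} (hm : m ∈ gr u) :
    (MvPolynomial.monomial d a : PolyR n K) • m ∈ gr (u + fun i => (d i : ℤ)) := by
  have key : ∀ (u : Fin n → ℤ) (m : M), m ∈ gr u →
      (MvPolynomial.monomial d 1 : PolyR n K) • m ∈ gr (u + fun i => (d i : ℤ)) := by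
    induction d using Finsupp.induction_linear with
    | zero =>
      intro u m hm
      have h0 : (u + fun i => (((0 : Fin n →₀ ℕ) i : ℕ) : ℤ)) = u := by ext; simp
      rw [h0]
      exact (one_smul (PolyR n K) m).symm ▸ hm
    | add d e hd he =>
      intro u m hm
      have := hd _ _ (he _ _ hm)
      rw [smul_smul, MvPolynomial.monomial_mul, one_mul] at this
      convert this using 2
      ext i
      simp
      ring
    | single i k =>
      induction k with
      | zero =>
        intro u m hm
        have h0 : (u + fun j => ((Finsupp.single i 0 j : ℕ) : ℤ)) = u := by ext; simp
        rw [h0, Finsupp.single_zero]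
        exact (one_smul (PolyR n K) m).symm ▸ hm
      | succ k ih =>
        intro u m hm
        have := ih _ _ (hX i _ _ hm)
        rw [X_eq_monomial, smul_smul, MvPolynomial.monomial_mul, one_mul,
          ← Finsupp.single_add] at this
        convert this using 2
        ext j
        by_cases h : i = j
        · subst h
          simp
          ring
        · simp [Ne.symm h]
  have h1 : (MvPolynomial.monomial d a : PolyR n K) = a • MvPolynomial.monomial d 1 := by
    rw [MvPolynomial.smul_monomial, smul_eq_mul, mul_one]
  rw [h1, smul_assoc]
  exact Submodule.smul_mem _ _ (key u m hm)

theorem FF.coords_mem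
    (hX : ∀ (i : Fin n) (u : Fin n → ℤ), ∀ m ∈ gr u,
      (MvPolynomial.X i : PolyR n K) • m ∈ gr (u + Pi.single i 1))
    {ι : Type} {co : K → ι →₀ K} {φ : ι → {r : Fin n →₀ ℕ // ∀ i, r i < p} → FF p n K M →+ M}
    (hφ : ∀ d a m j r, φ j r (FF.mono p d a m) =
      if expMod p d = r then
        (MvPolynomial.monomial (expDiv p d) (co a j) : PolyR n K) • m else 0)
    {u : Fin n → ℤ} {x : FF p n K M} (hx : x ∈ FF.comp p n K M gr u) (j : ι)
    (r : {r : Fin n →₀ ℕ // ∀ i, r i < p}) :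
    φ j r x ∈ gr (fun k => u k / p) ∧ ((∃ i, (r.1 i : ℤ) ≠ u i % p) → φ j r x = 0) := by
  have hp : (p : ℤ) ≠ 0 := by exact_mod_cast (Fact.out : p.Prime).ne_zero
  refine FF.comp_induction (P := fun x => φ j r x ∈ gr (fun k => u k / p) ∧
    ((∃ i, (r.1 i : ℤ) ≠ u i % p) → φ j r x = 0)) ?_ (fun x y hx hy => ?_)
    (fun d a v m hm hd => ?_) hx
  · simp
  · rw [map_add]
    exact ⟨Submodule.add_mem _ hx.1 hy.1, fun h => by rw [hx.2 h, hy.2 h, add_zero]⟩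
  · subst hd
    rw [hφ]
    split_ifs with h
    · constructor
      · convert monomial_smul_mem hX (expDiv p d) (co a j) hm using 2
        ext k
        simp [expDiv, Int.add_mul_ediv_left _ _ hp]
        ring
      · rintro ⟨i, hi⟩
        refine absurd ?_ hi
        rw [← h]
        simp [expMod]
    · exact ⟨Submodule.zero_mem _, fun _ => rfl⟩

theorem FF.eq_zero_of_X_smul_eq_zero
    (hX : ∀ (i : Fin n) (u : Fin n → ℤ), ∀ m ∈ gr u,
      (MvPolynomial.X i : PolyR n K) • m ∈ gr (u + Pi.single i 1))
    {i : Fin n} {u : Fin n → ℤ}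
    (hinj : u i % p = p - 1 →
      ∀ m ∈ gr (fun k => u k / p), (MvPolynomial.X i : PolyR n K) • m = 0 → m = 0)
    {x : FF p n K M} (hx : x ∈ FF.comp p n K M gr u)
    (h0 : (MvPolynomial.X i : PolyR n K) • x = 0) : x = 0 := by
  obtain ⟨ι, co, φ, hφ0, hφ⟩ := FF.exists_coords p n K M
  refine hφ0 x fun j r => ?_
  by_contra hne
  obtain ⟨hmem, hres⟩ := FF.coords_mem hX hφ hx j r
  have hri : (r.1 i : ℤ) = u i % p := by
    by_contra h
    exact hne (hres ⟨i, h⟩)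
  have key := FF.coords_monomial_smul hφ (Finsupp.single i 1) x j r
  rw [← X_eq_monomial, h0, map_zero] at key
  have hp := (Fact.out : p.Prime).two_le
  by_cases h : r.1 i + 1 = p
  · have hdiv : expDiv p (Finsupp.single i 1 + r.1) = Finsupp.single i 1 := by
      ext k
      by_cases hk : i = k
      · subst hk
        simp [expDiv, add_comm 1, h, Nat.div_self (by omega : 0 < p)]
      · simp [expDiv, hk, Nat.div_eq_of_lt (r.2 k)]
    rw [hdiv, ← X_eq_monomial] at key
    exact hne (hinj (by omega) _ hmem key.symm)
  · have hdiv : expDiv p (Finsupp.single i 1 + r.1) = 0 := by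
      ext k
      have := r.2 k
      by_cases hk : i = k
      · subst hk
        have : 1 + r.1 i < p := by omega
        simp [expDiv, Nat.div_eq_of_lt this]
      · simp [expDiv, hk, Nat.div_eq_of_lt this]
    rw [hdiv] at key
    exact hne ((one_smul (PolyR n K) (φ j r x)).symm.trans key.symm)

/-- Multiplication by `Xᵢ` is bijective `M_u → M_{u + eᵢ}` as soon as `uᵢ ≠ -1`. -/
theorem X_smul_bijective_of_ne (hint : DirectSum.IsInternal gr)
    (hX : ∀ (i : Fin n) (u : Fin n → ℤ), ∀ m ∈ gr u,
      (MvPolynomial.X i : PolyR n K) • m ∈ gr (u + Pi.single i 1))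
    (θ : M ≃ₗ[PolyR n K] FF p n K M)
    (hθ : ∀ (u : Fin n → ℤ), ∀ m ∈ gr u, θ m ∈ FF.comp p n K M gr u)
    {i : Fin n} {u : Fin n → ℤ} (hu : u i ≠ -1) :
    (∀ m ∈ gr u, (MvPolynomial.X i : PolyR n K) • m = 0 → m = 0) ∧
    ∀ m ∈ gr (u + Pi.single i 1), ∃ m' ∈ gr u, (MvPolynomial.X i : PolyR n K) • m' = m := by
  induction h : (u i).natAbs using Nat.strong_induction_on generalizing u with
  | _ N ih =>
  subst h
  have hp := (Fact.out : p.Prime).two_le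
  have step : u i % p = p - 1 → ∀ v : Fin n → ℤ, v i = u i / p →
      (∀ m ∈ gr v, (MvPolynomial.X i : PolyR n K) • m = 0 → m = 0) ∧
      ∀ m ∈ gr (v + Pi.single i 1), ∃ m' ∈ gr v,
        (MvPolynomial.X i : PolyR n K) • m' = m := by
    intro hmod v hv
    have hdm := Int.emod_add_mul_ediv (u i) p
    rw [hmod, ← hv] at hdm
    have h1 : u i + 1 = p * (v i + 1) := by linarith
    have h2 : v i + 1 ≠ 0 := fun h => hu (by rw [h, mul_zero] at h1; omega)
    refine ih (v i).natAbs ?_ (by omega) rfl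
    have hp' : (2 : ℤ) ≤ p := by exact_mod_cast hp
    rcases lt_or_gt_of_ne h2 with h2 | h2
    · have : u i + 1 ≤ 2 * (v i + 1) := by nlinarith
      omega
    · have : 2 * (v i + 1) ≤ u i + 1 := by nlinarith
      omega
  constructor
  · intro m hm h0
    rw [← θ.map_eq_zero_iff]
    refine FF.eq_zero_of_X_smul_eq_zero hX (fun hmod => (step hmod _ rfl).1) (hθ u m hm) ?_
    rw [← map_smul, h0, map_zero]
  · intro m hm
    obtain ⟨x, -, hx⟩ := FF.exists_X_smul_eq (fun hmod v hv => (step hmod v hv).2) (hθ _ m hm)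
    have hxm : (MvPolynomial.X i : PolyR n K) • θ.symm x = m := by
      rw [← map_smul, hx, θ.symm_apply_apply]
    obtain ⟨m', hm', h⟩ := exists_X_smul_eq_of_isInternal hint hX (m := θ.symm x) (hxm ▸ hm)
    exact ⟨m', hm', h.trans hxm⟩

theorem nonempty_equiv_add_single
    (hX : ∀ (i : Fin n) (u : Fin n → ℤ), ∀ m ∈ gr u,
      (MvPolynomial.X i : PolyR n K) • m ∈ gr (u + Pi.single i 1))
    {i : Fin n} {u : Fin n → ℤ}
    (h : (∀ m ∈ gr u, (MvPolynomial.X i : PolyR n K) • m = 0 → m = 0) ∧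
      ∀ m ∈ gr (u + Pi.single i 1), ∃ m' ∈ gr u, (MvPolynomial.X i : PolyR n K) • m' = m) :
    Nonempty (gr u ≃ₗ[K] gr (u + Pi.single i 1)) := by
  let f : gr u →ₗ[K] gr (u + Pi.single i 1) :=
    ((Algebra.lsmul K K M (MvPolynomial.X i : PolyR n K)).restrict (hX i u))
  refine ⟨LinearEquiv.ofBijective f ⟨?_, fun m => ?_⟩⟩
  · rw [injective_iff_map_eq_zero]
    exact fun m hm => Subtype.ext (h.1 m m.2 (congrArg Subtype.val hm))
  · obtain ⟨m', hm', hmm⟩ := h.2 m m.2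
    exact ⟨⟨m', hm'⟩, Subtype.ext hmm⟩

end Graded

end FrobeniusTensor

/-- An equivalence relation on `ℤⁿ` that relates `u` to `u + eᵢ` whenever `uᵢ ≠ -1` relates any two
points of a block. -/
theorem rel_of_mem_block {n : ℕ} {E : (Fin n → ℤ) → (Fin n → ℤ) → Prop} (hE : Equivalence E)
    (hstep : ∀ (i : Fin n) (u : Fin n → ℤ), u i ≠ -1 → E u (u + Pi.single i 1))
    {U : Set (Fin n)} {u v : Fin n → ℤ} (hu : u ∈ Block n U) (hv : v ∈ Block n U) : E u v := by
  classical
  have hupd : ∀ (i : Fin n) (w : Fin n → ℤ) (t : ℤ), t ≠ -1 →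
      E (Function.update w i t) (Function.update w i (t + 1)) := by
    intro i w t ht
    convert hstep i (Function.update w i t) (by simpa using ht) using 1
    ext k
    by_cases hk : k = i
    · subst hk
      simp
    · simp [hk]
  have hnonneg : ∀ (i : Fin n) (w : Fin n → ℤ) (t : ℤ), 0 ≤ t →
      E (Function.update w i 0) (Function.update w i t) := by
    intro i w t ht
    induction t, ht using Int.leInduction with
    | base => exact hE.refl _
    | succ t ht ih => exact hE.trans ih (hupd i w t (by omega))
  have hneg : ∀ (i : Fin n) (w : Fin n → ℤ) (t : ℤ), t ≤ -1 →
      E (Function.update w i (-1)) (Function.update w i t) := by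
    intro i w t ht
    induction t, ht using Int.leInductionDown with
    | base => exact hE.refl _
    | pred t ht ih =>
      refine hE.trans ih (hE.symm ?_)
      simpa using hupd i w (t - 1) (by omega)
  have hcoord : ∀ (i : Fin n) (w : Fin n → ℤ), w i = u i → E w (Function.update w i (v i)) := by
    intro i w hw
    have hw' : Function.update w i (u i) = w := by rw [← hw, Function.update_eq_self]
    by_cases hi : i ∈ U
    · have := hE.trans (hE.symm (hnonneg i w _ ((hu i).1 hi))) (hnonneg i w _ ((hv i).1 hi))
      rwa [hw'] at this
    · have := hE.trans (hE.symm (hneg i w _ ((hu i).2 hi))) (hneg i w _ ((hv i).2 hi))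
      rwa [hw'] at this
  have hs : ∀ s : Finset (Fin n), E u (s.piecewise v u) := by
    intro s
    induction s using Finset.induction_on with
    | empty => simpa using hE.refl u
    | insert i s hi ih =>
      rw [Finset.piecewise_insert]
      exact hE.trans ih (hcoord i _ (by simp [hi]))
  simpa using hs Finset.univ

theorem block_nonempty (n : ℕ) (U : Set (Fin n)) : (Block n U).Nonempty := by
  classical
  exact ⟨fun i => if i ∈ U then 0 else -1, fun i => ⟨fun h => by simp [h], fun h => by simp [h]⟩⟩

/-- **Theorem 4.3, rigidity.** Let `M` be a `ℤⁿ`-graded `F`-finite `F`-module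
over `R = K[X₁,…,Xₙ]`, `char K = p > 0`, and let `U ⊆ {1,…,n}`.  Then `M_u ≠ 0` for all
`u ∈ B(U)` iff `M_w ≠ 0` for some `w ∈ B(U)`; moreover any two components indexed by `B(U)`
are isomorphic as `K`-vector spaces. -/
theorem rigidity_on_blocks
    (p n : ℕ) [Fact p.Prime] (K : Type) [Field K] [CharP K p]
    (M : Type) [AddCommGroup M] [Module K M] [Module (PolyR n K) M]
    [IsScalarTower K (PolyR n K) M]
    (gr : (Fin n → ℤ) → Submodule K M)
    (hM : ZGradedFFiniteFModule p n K M gr)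
    (U : Set (Fin n)) :
    ((∀ u ∈ Block n U, gr u ≠ ⊥) ↔ (∃ w ∈ Block n U, gr w ≠ ⊥)) ∧
    (∀ u ∈ Block n U, ∀ v ∈ Block n U, Nonempty (↥(gr u) ≃ₗ[K] ↥(gr v))) := by
  have key : ∀ u ∈ Block n U, ∀ v ∈ Block n U, Nonempty (↥(gr u) ≃ₗ[K] ↥(gr v)) := by
    intro u hu v hv
    refine rel_of_mem_block (E := fun u v => Nonempty (↥(gr u) ≃ₗ[K] ↥(gr v)))
      ⟨fun u => ⟨.refl K _⟩, fun ⟨e⟩ => ⟨e.symm⟩, fun ⟨e⟩ ⟨f⟩ => ⟨e.trans f⟩⟩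
      (fun i u hui => ?_) hu hv
    exact nonempty_equiv_add_single hM.smul_X_mem
      (X_smul_bijective_of_ne hM.isInternal hM.smul_X_mem hM.theta hM.theta_grade hui)
  refine ⟨⟨fun h => ?_, ?_⟩, key⟩
  · obtain ⟨w, hw⟩ := block_nonempty n U
    exact ⟨w, hw, h w hw⟩
  · rintro ⟨w, hw, hne⟩ u hu h0
    obtain ⟨e⟩ := key w hw u hu
    rw [← Submodule.nontrivial_iff_ne_bot] at hne
    have := e.symm.toEquiv.nontrivial
    exact (Submodule.nontrivial_iff_ne_bot.mp this) h0
end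
end

section
/- Let K be a field of characteristic p > 0 and let M be a ℤⁿ-graded F-finite F-module over R = K[X₁,…,Xₙ]. Then every graded component of M is a finite-dimensional K-vector space: dim_K M_u < ∞ for all u ∈ ℤⁿ. -/
set_option maxHeartbeats 1000000
set_option synthInstance.maxHeartbeats 1000000

open scoped TensorProduct

noncomputable section

variable {p n : ℕ} {A : Type} [CommRing A] [Fact p.Prime] [CharP A p]

open MvPolynomial in
lemma IsHomog.eq_zero_or_monomial {n : ℕ} {A : Type} [CommRing A] {r : PolyR n A}
    {d : Fin n → ℤ} (hr : IsHomog r d) :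
    r = 0 ∨ ∃ (a : Fin n →₀ ℕ) (c : A), (fun i => ((a i : ℕ) : ℤ)) = d ∧ r = monomial a c := by
  by_cases h0 : r = 0
  · exact Or.inl h0
  obtain ⟨a, ha⟩ := Finset.nonempty_of_ne_empty (mt support_eq_empty.mp h0)
  refine Or.inr ⟨a, coeff a r, hr a ha, ?_⟩
  ext b
  rw [coeff_monomial]
  split_ifs with hab
  · rw [hab]
  by_contra hb
  have hfun := (hr a ha).trans (hr b (mem_support_iff.mpr hb)).symm
  exact hab (Finsupp.ext fun i => by exact_mod_cast congrFun hfun i)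

lemma isHomog_monomial {n : ℕ} {A : Type} [CommRing A] (a : Fin n →₀ ℕ) (c : A) :
    IsHomog (MvPolynomial.monomial a c : PolyR n A) (fun i => ((a i : ℕ) : ℤ)) := by
  intro m hm
  rw [Finset.mem_singleton.mp (MvPolynomial.support_monomial_subset hm)]

/-- Compatibility of a grading on an `R`-module with multiplication by all monomials follows from
compatibility with multiplication by the variables. -/
lemma monomial_smul_mem_of_X_smul_mem {M : Type} [AddCommGroup M] [Module A M]
    [Module (PolyR n A) M] {gr : (Fin n → ℤ) → Submodule A M}
    (h : ∀ (i : Fin n) (u : Fin n → ℤ), ∀ m ∈ gr u,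
      (MvPolynomial.X i : PolyR n A) • m ∈ gr (u + Pi.single i 1)) (a : Fin n →₀ ℕ) :
    ∀ (u : Fin n → ℤ), ∀ m ∈ gr u,
      (MvPolynomial.monomial a 1 : PolyR n A) • m ∈ gr (u + fun i => ((a i : ℕ) : ℤ)) := by
  induction a using Finsupp.induction_linear with
  | zero =>
    intro u m hm
    have h0 : (MvPolynomial.monomial 0 1 : PolyR n A) = 1 := rfl
    rw [h0, one_smul]
    convert hm
    ext i
    simp
  | add a b ha hb =>
    intro u m hm
    have hab : (MvPolynomial.monomial (a + b) 1 : PolyR n A) =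
        MvPolynomial.monomial a 1 * MvPolynomial.monomial b 1 := by
      rw [MvPolynomial.monomial_mul, one_mul]
    rw [hab, mul_smul]
    convert ha _ _ (hb u m hm) using 2
    ext i
    simp only [Pi.add_apply, Finsupp.add_apply]
    push_cast
    ring
  | single j k =>
    rw [← MvPolynomial.X_pow_eq_monomial]
    induction k with
    | zero =>
      intro u m hm
      rw [pow_zero, one_smul]
      convert hm
      ext i
      simp
    | succ k ih =>
      intro u m hm
      rw [pow_succ', mul_smul]
      convert h j _ _ (ih u m hm) using 2
      ext i
      by_cases hij : i = j
      · subst hij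
        simp
        ring
      · simp [hij, Finsupp.single_apply, Ne.symm hij]

lemma FF.smul_of_tmul {M : Type} [AddCommGroup M] [Module (PolyR n A) M]
    (s r : PolyR n A) (m : M) :
    s • FF.of p n A M (twist p n A r ⊗ₜ[PolyR n A] m) =
      FF.of p n A M (twist p n A (s * r) ⊗ₜ[PolyR n A] m) := rfl

lemma FF.scalar_smul_of_tmul {M : Type} [AddCommGroup M] [Module (PolyR n A) M]
    (c : A) (r : PolyR n A) (m : M) :
    c • FF.of p n A M (twist p n A r ⊗ₜ[PolyR n A] m) =
      FF.of p n A M (twist p n A (MvPolynomial.C c * r) ⊗ₜ[PolyR n A] m) := rfl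

lemma FF.of_tmul_smul {M : Type} [AddCommGroup M] [Module (PolyR n A) M]
    (s r : PolyR n A) (m : M) :
    FF.of p n A M (twist p n A r ⊗ₜ[PolyR n A] (s • m)) =
      FF.of p n A M (twist p n A (s ^ p * r) ⊗ₜ[PolyR n A] m) := by
  rw [← TensorProduct.smul_tmul, Algebra.smul_def]
  rfl

lemma FF.of_add {M : Type} [AddCommGroup M] [Module (PolyR n A) M]
    (x y : FrobTwist p n A ⊗[PolyR n A] M) :
    FF.of p n A M (x + y) = FF.of p n A M x + FF.of p n A M y := rfl

lemma FF.of_zero {M : Type} [AddCommGroup M] [Module (PolyR n A) M] :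
    FF.of p n A M 0 = 0 := rfl

/-- If the `f i` span `m`, then the tensors `r ⊗ f i` span `r ⊗ m`. -/
lemma FF.of_tmul_mem_span {M ι : Type} [AddCommGroup M] [Module A M] [Module (PolyR n A) M]
    [IsScalarTower A (PolyR n A) M] (r : PolyR n A) (f : ι → M) {m : M}
    (hm : m ∈ Submodule.span A (Set.range f)) :
    FF.of p n A M (twist p n A r ⊗ₜ[PolyR n A] m) ∈
      Submodule.span A
        (Set.range fun i => FF.of p n A M (twist p n A r ⊗ₜ[PolyR n A] f i)) := by
  induction hm using Submodule.span_induction with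
  | mem x hx =>
    obtain ⟨i, rfl⟩ := hx
    exact Submodule.subset_span ⟨i, rfl⟩
  | zero =>
    rw [TensorProduct.tmul_zero, FF.of_zero]
    exact Submodule.zero_mem _
  | add x y _ _ hx hy =>
    rw [TensorProduct.tmul_add, FF.of_add]
    exact Submodule.add_mem _ hx hy
  | smul c x _ hx =>
    have hc : c • x = (MvPolynomial.C c : PolyR n A) • x := by
      rw [← MvPolynomial.algebraMap_eq, algebraMap_smul]
    rw [hc, FF.of_tmul_smul, ← MvPolynomial.C_pow, ← FF.scalar_smul_of_tmul]
    exact Submodule.smul_mem _ _ hx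

/-- The degree-`u` component of `F(M)` is spanned by `Xᵉ ⊗ M_v`, where `v = ⌊u / p⌋` and
`u = e + p • v`. -/
lemma FF.comp_le_span {M ι : Type} [AddCommGroup M] [Module A M] [Module (PolyR n A) M]
    [IsScalarTower A (PolyR n A) M] {gr : (Fin n → ℤ) → Submodule A M}
    (h : ∀ (i : Fin n) (u : Fin n → ℤ), ∀ m ∈ gr u,
      (MvPolynomial.X i : PolyR n A) • m ∈ gr (u + Pi.single i 1))
    (u : Fin n → ℤ) (f : ι → M)
    (hf : gr (fun i => u i / p) ≤ Submodule.span A (Set.range f)) :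
    FF.comp p n A M gr u ≤ Submodule.span A (Set.range fun i => FF.of p n A M
      (twist p n A (MvPolynomial.monomial
        (Finsupp.equivFunOnFinite.symm fun j => (u j % p).toNat) 1) ⊗ₜ[PolyR n A] f i)) := by
  have hp : (p : ℤ) ≠ 0 := by exact_mod_cast (Fact.out : p.Prime).ne_zero
  refine Submodule.span_le.mpr ?_
  rintro _ ⟨r, d, v, m, hr, hm, rfl, rfl⟩
  obtain rfl | ⟨a, c, rfl, rfl⟩ := hr.eq_zero_or_monomial
  · have h0 : twist p n A 0 = 0 := rfl
    rw [h0, TensorProduct.zero_tmul, FF.of_zero]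
    exact Submodule.zero_mem _
  set e : Fin n →₀ ℕ := Finsupp.equivFunOnFinite.symm fun j =>
    ((((fun i => ((a i : ℕ) : ℤ)) + p • v) j) % p).toNat with he
  set b : Fin n →₀ ℕ := Finsupp.equivFunOnFinite.symm fun j => a j / p with hb
  have hej : ∀ j, e j = a j % p := by
    intro j
    have : (((a j : ℕ) : ℤ) + p * v j) % p = ((a j % p : ℕ) : ℤ) := by
      rw [Int.add_mul_emod_self_left]
      norm_cast
    change ((((a j : ℕ) : ℤ) + p • v j) % p).toNat = a j % p
    rw [nsmul_eq_mul, this, Int.toNat_natCast]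
  have hae : a = p • b + e := by
    ext j
    simp [hej, hb, Nat.div_add_mod]
  have hmon : (MvPolynomial.monomial a c : PolyR n A) =
      MvPolynomial.C c *
        ((MvPolynomial.monomial b 1) ^ p * MvPolynomial.monomial e 1) := by
    rw [MvPolynomial.monomial_pow, MvPolynomial.monomial_mul, MvPolynomial.C_mul_monomial,
      one_pow, one_mul, mul_one, ← hae]
  rw [hmon, ← FF.scalar_smul_of_tmul, ← FF.of_tmul_smul]
  refine Submodule.smul_mem _ _ (FF.of_tmul_mem_span _ f (hf ?_))
  convert monomial_smul_mem_of_X_smul_mem h b v m hm using 2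
  ext j
  change (((a j : ℕ) : ℤ) + p • v j) / p = v j + ((a j / p : ℕ) : ℤ)
  rw [nsmul_eq_mul, Int.add_mul_ediv_left _ _ hp, add_comm]
  push_cast
  rfl

lemma FF.X_smul_mem_comp {M : Type} [AddCommGroup M] [Module A M] [Module (PolyR n A) M]
    {gr : (Fin n → ℤ) → Submodule A M} (i : Fin n) (u : Fin n → ℤ) :
    ∀ x ∈ FF.comp p n A M gr u,
      (MvPolynomial.X i : PolyR n A) • x ∈ FF.comp p n A M gr (u + Pi.single i 1) := by
  intro x hx
  induction hx using Submodule.span_induction with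
  | mem x hx =>
    obtain ⟨r, d, v, m, hr, hm, rfl, rfl⟩ := hx
    refine Submodule.subset_span
      ⟨MvPolynomial.X i * r, d + Pi.single i 1, v, m, ?_, hm, by abel, FF.smul_of_tmul _ _ _⟩
    intro b hb
    rw [MvPolynomial.support_X_mul, Finset.mem_map] at hb
    obtain ⟨a, ha, rfl⟩ := hb
    rw [← hr a ha]
    ext j
    by_cases hij : j = i
    · subst hij
      simp [add_comm]
    · simp [hij]
  | zero => rw [smul_zero]; exact Submodule.zero_mem _
  | add x y _ _ hx hy => rw [smul_add]; exact Submodule.add_mem _ hx hy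
  | smul c x _ hx => rw [smul_comm]; exact Submodule.smul_mem _ _ hx

lemma FF.iSup_comp_eq_top {M : Type} [AddCommGroup M] [Module A M] [Module (PolyR n A) M]
    {gr : (Fin n → ℤ) → Submodule A M} (h : ⨆ u, gr u = ⊤) :
    ⨆ u, FF.comp p n A M gr u = ⊤ := by
  rw [eq_top_iff]
  rintro x -
  refine TensorProduct.induction_on (motive := fun x =>
    FF.of p n A M x ∈ ⨆ u, FF.comp p n A M gr u) x (Submodule.zero_mem _) ?_
    fun x y hx hy => Submodule.add_mem _ hx hy
  intro r m
  have hm : m ∈ ⨆ u, gr u := h ▸ Submodule.mem_top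
  induction hm using Submodule.iSup_induction' with
  | mem v m hm =>
    refine MvPolynomial.induction_on' (P := fun r : PolyR n A =>
      FF.of p n A M (twist p n A r ⊗ₜ[PolyR n A] m) ∈ ⨆ u, FF.comp p n A M gr u) r ?_ ?_
    · exact fun a c => Submodule.mem_iSup_of_mem _
        (Submodule.subset_span ⟨_, _, v, m, isHomog_monomial a c, hm, rfl, rfl⟩)
    · intro r s hr hs
      have hrs : twist p n A (r + s) = twist p n A r + twist p n A s := rfl
      rw [hrs, TensorProduct.add_tmul, FF.of_add]
      exact Submodule.add_mem _ hr hs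
  | zero =>
    rw [TensorProduct.tmul_zero]
    exact Submodule.zero_mem _
  | add x y _ _ hx hy =>
    rw [TensorProduct.tmul_add]
    exact Submodule.add_mem _ hx hy

lemma FF.map_mem_comp {M N : Type} [AddCommGroup M] [Module A M] [Module (PolyR n A) M]
    [AddCommGroup N] [Module A N] [Module (PolyR n A) N]
    {gr : (Fin n → ℤ) → Submodule A M} {gr' : (Fin n → ℤ) → Submodule A N}
    (f : M →ₗ[PolyR n A] N) (hf : ∀ u, ∀ x ∈ gr u, f x ∈ gr' u) (u : Fin n → ℤ) :
    ∀ x ∈ FF.comp p n A M gr u, FF.map p n A f x ∈ FF.comp p n A N gr' u := by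
  intro x hx
  induction hx using Submodule.span_induction with
  | mem x hx =>
    obtain ⟨r, d, v, m, hr, hm, hu, rfl⟩ := hx
    exact Submodule.subset_span ⟨r, d, v, f m, hr, hf v m hm, hu, rfl⟩
  | zero => rw [map_zero]; exact Submodule.zero_mem _
  | add x y _ _ hx hy => rw [map_add]; exact Submodule.add_mem _ hx hy
  | smul c x _ hx =>
    rw [LinearMap.map_smul_of_tower]
    exact Submodule.smul_mem _ _ hx

namespace GrMod

lemma X_smul_mem_FPow (X : GrMod p n A)
    (h : ∀ (i : Fin n) (u : Fin n → ℤ), ∀ x ∈ X.gr u,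
      (MvPolynomial.X i : PolyR n A) • x ∈ X.gr (u + Pi.single i 1)) (k : ℕ) :
    ∀ (i : Fin n) (u : Fin n → ℤ), ∀ x ∈ (X.FPow k).gr u,
      (MvPolynomial.X i : PolyR n A) • x ∈ (X.FPow k).gr (u + Pi.single i 1) := by
  cases k with
  | zero => exact h
  | succ k => exact fun i u => FF.X_smul_mem_comp i u

lemma iSup_FPow_gr_eq_top (X : GrMod p n A) (h : ⨆ u, X.gr u = ⊤) (k : ℕ) :
    ⨆ u, (X.FPow k).gr u = ⊤ := by
  induction k with
  | zero => exact h
  | succ k ih => exact FF.iSup_comp_eq_top ih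

lemma seqMap_mem_gr (X : GrMod p n A) (β : X.carrier →ₗ[PolyR n A] X.F.carrier)
    (hβ : ∀ u, ∀ x ∈ X.gr u, β x ∈ X.F.gr u) (k : ℕ) :
    ∀ u, ∀ x ∈ (X.FPow k).gr u, X.seqMap β k x ∈ (X.FPow (k + 1)).gr u := by
  induction k with
  | zero => exact hβ
  | succ k ih => exact fun u => FF.map_mem_comp _ ih u

/-- A component of `F^k(X)` needs at most as many generators as the component of `X` in the degree
obtained by taking `⌊· / p⌋` in each coordinate `k` times. -/
lemma exists_FPow_gr_le_span (X : GrMod p n A)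
    (h : ∀ (i : Fin n) (u : Fin n → ℤ), ∀ x ∈ X.gr u,
      (MvPolynomial.X i : PolyR n A) • x ∈ X.gr (u + Pi.single i 1))
    {ι : Type} (f : ι → X.carrier) (k : ℕ) (u : Fin n → ℤ)
    (hf : X.gr ((fun (v : Fin n → ℤ) i => v i / (p : ℤ))^[k] u) ≤
      Submodule.span A (Set.range f)) :
    ∃ g : ι → (X.FPow k).carrier, (X.FPow k).gr u ≤ Submodule.span A (Set.range g) := by
  induction k generalizing u with
  | zero => exact ⟨f, hf⟩
  | succ k ih =>
    obtain ⟨g, hg⟩ := ih (fun i => u i / (p : ℤ)) hf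
    exact ⟨_, FF.comp_le_span (X.X_smul_mem_FPow h k) u g hg⟩

end GrMod

/-- If subspaces of the components of an independent family together span everything, then they
are the whole components. -/
lemma iSupIndep.eq_of_le_of_iSup_eq_top {ι R M : Type*} [Ring R] [AddCommGroup M] [Module R M]
    {gr W : ι → Submodule R M} (hgr : iSupIndep gr) (hle : ∀ i, W i ≤ gr i)
    (htop : ⨆ i, W i = ⊤) (i : ι) : W i = gr i := by
  refine le_antisymm (hle i) fun x hx => ?_
  have htop' : ⨆ j, W j ≤ W i ⊔ ⨆ (j) (_ : j ≠ i), W j := by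
    refine iSup_le fun j => ?_
    by_cases hj : j = i
    · exact hj ▸ le_sup_left
    · exact le_sup_of_le_right (le_iSup₂_of_le j hj le_rfl)
  have hx' : x ∈ W i ⊔ ⨆ (j) (_ : j ≠ i), W j := htop' (htop ▸ Submodule.mem_top)
  obtain ⟨a, ha, b, hb, rfl⟩ := Submodule.mem_sup.mp hx'
  have hb0 : b = 0 := by
    refine Submodule.disjoint_def.mp (hgr i) b ?_ ((iSup₂_mono fun j _ => hle j) hb)
    simpa using Submodule.sub_mem _ hx (hle i ha)
  rwa [hb0, add_zero]

/-- The components of a finitely generated graded module over a polynomial ring are finitely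
generated over the coefficients. -/
lemma gr_fg_of_finite {M : Type} [AddCommGroup M] [Module A M] [Module (PolyR n A) M]
    [IsScalarTower A (PolyR n A) M] [Module.Finite (PolyR n A) M]
    {gr : (Fin n → ℤ) → Submodule A M} (hgr : DirectSum.IsInternal gr)
    (h : ∀ (i : Fin n) (u : Fin n → ℤ), ∀ m ∈ gr u,
      (MvPolynomial.X i : PolyR n A) • m ∈ gr (u + Pi.single i 1)) (u : Fin n → ℤ) :
    (gr u).FG := by
  classical
  -- finitely many homogeneous generators
  obtain ⟨S, hS⟩ := (Module.Finite.fg_top : (⊤ : Submodule (PolyR n A) M).FG)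
  have hdec : ∀ x : M, ∃ T : Finset ((Fin n → ℤ) × M), (∀ t ∈ T, t.2 ∈ gr t.1) ∧
      x ∈ Submodule.span A (Prod.snd '' (T : Set ((Fin n → ℤ) × M))) := by
    intro x
    have hx : x ∈ ⨆ v, gr v := hgr.submodule_iSup_eq_top ▸ Submodule.mem_top
    induction hx using Submodule.iSup_induction' with
    | mem v x hx =>
      exact ⟨{(v, x)}, by simpa using hx, Submodule.subset_span (by simp)⟩
    | zero => exact ⟨∅, by simp, Submodule.zero_mem _⟩
    | add x y _ _ hx hy =>
      obtain ⟨T, hT, hxT⟩ := hx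
      obtain ⟨T', hT', hyT⟩ := hy
      refine ⟨T ∪ T', fun t ht => (Finset.mem_union.mp ht).elim (hT t) (hT' t), ?_⟩
      rw [Finset.coe_union, Set.image_union]
      exact Submodule.add_mem _ (Submodule.span_mono Set.subset_union_left hxT)
        (Submodule.span_mono Set.subset_union_right hyT)
  choose T hT hxT using hdec
  set G : Finset ((Fin n → ℤ) × M) := S.biUnion T with hG
  have hGgr : ∀ t ∈ G, t.2 ∈ gr t.1 := by
    intro t ht
    obtain ⟨x, -, hx⟩ := Finset.mem_biUnion.mp ht
    exact hT x t hx
  let W : (Fin n → ℤ) → Submodule A M := fun v => Submodule.span A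
    {x | ∃ t ∈ G, ∃ a : Fin n →₀ ℕ, (t.1 + fun i => ((a i : ℕ) : ℤ)) = v ∧
      x = (MvPolynomial.monomial a 1 : PolyR n A) • t.2}
  have hWle : ∀ v, W v ≤ gr v := by
    intro v
    refine Submodule.span_le.mpr ?_
    rintro _ ⟨t, ht, a, rfl, rfl⟩
    exact monomial_smul_mem_of_X_smul_mem h a t.1 t.2 (hGgr t ht)
  have hWtop : ⨆ v, W v = ⊤ := by
    rw [eq_top_iff]
    rintro x -
    have hspan : x ∈ Submodule.span (PolyR n A) (Prod.snd '' (G : Set ((Fin n → ℤ) × M))) := by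
      have hle : Submodule.span (PolyR n A) (S : Set M) ≤
          Submodule.span (PolyR n A) (Prod.snd '' (G : Set ((Fin n → ℤ) × M))) := by
        refine Submodule.span_le.mpr fun y hy => ?_
        refine Submodule.span_le_restrictScalars A (PolyR n A) _
          (Submodule.span_mono (Set.image_mono ?_) (hxT y))
        exact_mod_cast Finset.subset_biUnion_of_mem T hy
      exact hle (hS ▸ Submodule.mem_top)
    rw [← Submodule.restrictScalars_mem A, ← Submodule.span_smul_of_span_eq_top
      (MvPolynomial.basisMonomials (Fin n) A).span_eq] at hspan
    refine Submodule.span_le.mpr ?_ hspan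
    rintro _ ⟨_, ⟨a, rfl⟩, _, ⟨t, ht, rfl⟩, rfl⟩
    refine Submodule.mem_iSup_of_mem _ (Submodule.subset_span ⟨t, ht, a, rfl, ?_⟩)
    simp only [MvPolynomial.coe_basisMonomials]
  rw [← hgr.submodule_iSupIndep.eq_of_le_of_iSup_eq_top hWle hWtop u]
  refine Submodule.fg_span (Set.Finite.subset (G.finite_toSet.image fun t =>
    (MvPolynomial.monomial
      (Finsupp.equivFunOnFinite.symm fun i => (u i - t.1 i).toNat) 1 : PolyR n A) • t.2) ?_)
  rintro _ ⟨t, ht, a, rfl, rfl⟩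
  refine ⟨t, ht, ?_⟩
  simp only
  congr 2
  ext i
  simp

/-- A directed union of subspaces that are each spanned by a family indexed by the same finite type
is finite-dimensional. -/
lemma Submodule.finiteDimensional_iSup_of_monotone {K V ι : Type} [Field K] [AddCommGroup V]
    [Module K V] [Finite ι] {W : ℕ → Submodule K V} (hW : Monotone W)
    (hspan : ∀ k, ∃ g : ι → V, W k ≤ Submodule.span K (Set.range g)) :
    FiniteDimensional K ↥(⨆ k, W k) := by
  have := Fintype.ofFinite ι
  have hfin : ∀ k, FiniteDimensional K (W k) := fun k =>
    let ⟨g, hg⟩ := hspan k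
    have := FiniteDimensional.span_of_finite K (Set.finite_range g)
    Submodule.finiteDimensional_of_le hg
  have hrank : ∀ k, Module.finrank K (W k) ≤ Fintype.card ι := fun k =>
    let ⟨g, hg⟩ := hspan k
    have := FiniteDimensional.span_of_finite K (Set.finite_range g)
    (Submodule.finrank_mono hg).trans (finrank_range_le_card g)
  obtain ⟨k, hk⟩ : ∃ k, ∀ j, Module.finrank K (W j) ≤ Module.finrank K (W k) := by
    obtain ⟨_, ⟨⟨k, rfl⟩, hk⟩⟩ := (Set.finite_Iic (Fintype.card ι)).subset
      (Set.range_subset_iff.mpr hrank) |>.exists_maximal (Set.range_nonempty _)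
    exact ⟨k, fun j => (le_total _ _).elim id (hk ⟨j, rfl⟩)⟩
  have hsup : ⨆ j, W j = W k := by
    refine le_antisymm (iSup_le fun j => ?_) (le_iSup W k)
    rw [Submodule.eq_of_le_of_finrank_le (hW (le_max_right j k)) (hk _)]
    exact hW (le_max_left j k)
  rw [hsup]
  exact hfin k

lemma finite_range_iterate_ediv (q : ℕ) (u : Fin n → ℤ) :
    (Set.range fun k : ℕ => (fun (v : Fin n → ℤ) i => v i / (q : ℤ))^[k] u).Finite := by
  refine (Set.finite_Icc (-|u|) |u|).subset ?_
  rintro _ ⟨k, rfl⟩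
  have habs : ∀ i, |((fun (v : Fin n → ℤ) i => v i / (q : ℤ))^[k] u) i| ≤ |u i| := by
    intro i
    induction k with
    | zero => exact le_rfl
    | succ k ih =>
      rw [Function.iterate_succ_apply']
      exact (Int.abs_ediv_le_abs _ _).trans ih
  exact ⟨fun i => (abs_le.mp (habs i)).1, fun i => (abs_le.mp (habs i)).2⟩

/-- **Theorem 4.4.** Every graded component of a `ℤⁿ`-graded `F`-finite
`F`-module over `K[X₁,…,Xₙ]` (`char K = p > 0`) is a finite-dimensional `K`-vector space. -/
theorem components_finite_dimensional
    (p n : ℕ) [Fact p.Prime] (K : Type) [Field K] [CharP K p]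
    (M : Type) [AddCommGroup M] [Module K M] [Module (PolyR n K) M]
    [IsScalarTower K (PolyR n K) M]
    (gr : (Fin n → ℤ) → Submodule K M)
    (hM : ZGradedFFiniteFModule p n K M gr) :
    ∀ u : Fin n → ℤ, FiniteDimensional K ↥(gr u) := by
  intro u
  have := hM.gen_fg
  let W : ℕ → (Fin n → ℤ) → Submodule K M := fun k v =>
    ((hM.gen.FPow k).gr v).map ((hM.toLim k).restrictScalars K)
  have hWle : ∀ v, ⨆ k, W k v ≤ gr v := by
    refine fun v => iSup_le fun k => ?_
    rintro _ ⟨x, hx, rfl⟩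
    exact hM.toLim_grade k v x hx
  have hWtop : ⨆ v, ⨆ k, W k v = ⊤ := by
    rw [iSup_comm, eq_top_iff]
    rintro m -
    obtain ⟨k, x, rfl⟩ := hM.toLim_surj m
    refine Submodule.mem_iSup_of_mem k ?_
    simp only [W, ← Submodule.map_iSup]
    rw [hM.gen.iSup_FPow_gr_eq_top hM.gen_internal.submodule_iSup_eq_top]
    exact ⟨x, Submodule.mem_top, rfl⟩
  have hmono : Monotone fun k => W k u := by
    refine monotone_nat_of_le_succ fun k => ?_
    rintro _ ⟨x, hx, rfl⟩
    exact ⟨_, hM.gen.seqMap_mem_gr hM.beta hM.beta_grade k u x hx, hM.toLim_compat k x⟩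
  obtain ⟨N, f, hf⟩ := Submodule.fg_iff_exists_fin_generating_family.mp
    (Submodule.fg_biSup (finite_range_iterate_ediv p u).toFinset _ fun v _ =>
      gr_fg_of_finite hM.gen_internal hM.gen_smul_X_mem v)
  have hspan : ∀ k, ∃ g : Fin N → M, W k u ≤ Submodule.span K (Set.range g) := by
    intro k
    obtain ⟨g, hg⟩ := hM.gen.exists_FPow_gr_le_span hM.gen_smul_X_mem f k u <| by
      rw [hf]
      exact le_iSup₂_of_le _ ((Set.Finite.mem_toFinset _).mpr ⟨k, rfl⟩) le_rfl
    refine ⟨fun i => hM.toLim k (g i), (Submodule.map_mono hg).trans ?_⟩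
    rw [Submodule.map_span, ← Set.range_comp]
    rfl
  rw [← hM.isInternal.submodule_iSupIndep.eq_of_le_of_iSup_eq_top hWle hWtop u]
  exact Submodule.finiteDimensional_iSup_of_monotone hmono hspan
end
end
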